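/- Let x̄ be a weak local minimizer of problem (P), and let F(x) := sup{ λ·(f(x) − f(x̄)) + μ·g(x) : (λ,μ) ∈ Λ }. Then the lower Hadamard directional derivative of F at x̄ satisfies d_H F(x̄; u) ≥ 0 for every direction u ∈ ℝ^s. -/

import Mathlib

open Filter Topology Pointwise

noncomputable section

/-- Euclidean dot product on `Fin n → ℝ`. -/
def dotp {n : ℕ} (a b : Fin n → ℝ) : ℝ := ∑ i, a i * b i

/-- Positive polar cone `C* = {l | l·x ≥ 0 for all x ∈ C}`. -/
def polarCone {n : ℕ} (C : Set (Fin n → ℝ)) : Set (Fin n → ℝ) :=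
  {l | ∀ x ∈ C, 0 ≤ dotp l x}

/-- A closed convex pointed cone with vertex at the origin. -/
def IsClosedConvexPointedCone {n : ℕ} (C : Set (Fin n → ℝ)) : Prop :=
  IsClosed C ∧ Convex ℝ C ∧ (0 : Fin n → ℝ) ∈ C ∧
    (∀ c : ℝ, 0 ≤ c → ∀ x ∈ C, c • x ∈ C) ∧ C ∩ (-C) ⊆ {0}

/-- The set Λ of normalized multiplier pairs. -/
def LambdaSet {n m : ℕ} (C : Set (Fin n → ℝ)) (K : Set (Fin m → ℝ)) :
    Set ((Fin n → ℝ) × (Fin m → ℝ)) :=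
  {p | p.1 ∈ polarCone C ∧ p.2 ∈ polarCone K ∧
    (∑ i, |p.1 i|) + (∑ j, |p.2 j|) = 1}

/-- `x̄` is a weak local minimizer of problem (P): no feasible point near `x̄`
has `f x ∈ f x̄ − int C`. -/
def WeakLocalMin {s n m : ℕ} (C : Set (Fin n → ℝ)) (K : Set (Fin m → ℝ))
    (X : Set (Fin s → ℝ)) (f : (Fin s → ℝ) → (Fin n → ℝ))
    (g : (Fin s → ℝ) → (Fin m → ℝ)) (xbar : Fin s → ℝ) : Prop :=
  ∃ N ∈ 𝓝 xbar, ∀ x ∈ N, x ∈ X → g x ∈ -K →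
    f x ∉ ({f xbar} : Set (Fin n → ℝ)) - interior C

/-- The auxiliary function `F(x) = sup{λ·(f x − f x̄) + μ·g x : (λ,μ) ∈ Λ}`. -/
def Ffun {s n m : ℕ} (C : Set (Fin n → ℝ)) (K : Set (Fin m → ℝ))
    (f : (Fin s → ℝ) → (Fin n → ℝ)) (g : (Fin s → ℝ) → (Fin m → ℝ))
    (xbar x : Fin s → ℝ) : ℝ :=
  sSup ((fun p => dotp p.1 (f x - f xbar) + dotp p.2 (g x)) '' LambdaSet C K)

/-- Lower Hadamard directional derivative,
`liminf_{t↓0, u'→u} (F(x + t u') − F(x))/t`, valued in `EReal`. -/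
def lowerHadamardDeriv {s : ℕ} (F : (Fin s → ℝ) → ℝ) (x u : Fin s → ℝ) : EReal :=
  liminf (fun p : ℝ × (Fin s → ℝ) =>
      (((F (x + p.1 • p.2) - F x) / p.1 : ℝ) : EReal))
    ((𝓝[>] (0 : ℝ)) ×ˢ 𝓝 u)

lemma exists_dotp_eq {n : ℕ} (φ : (Fin n → ℝ) →L[ℝ] ℝ) :
    ∃ l : Fin n → ℝ, ∀ y, φ y = dotp l y := by
  refine ⟨fun i => φ (fun j => if i = j then 1 else 0), fun y => ?_⟩
  have h := LinearMap.pi_apply_eq_sum_univ (φ : (Fin n → ℝ) →ₗ[ℝ] ℝ) y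
  simp only [ContinuousLinearMap.coe_coe, smul_eq_mul] at h
  rw [h, dotp]
  exact Finset.sum_congr rfl fun i _ => mul_comm _ _

lemma dotp_smul_left {n : ℕ} (c : ℝ) (a b : Fin n → ℝ) :
    dotp (c • a) b = c * dotp a b := by
  simp [dotp, Finset.mul_sum, mul_assoc]

lemma dotp_neg_right {n : ℕ} (a b : Fin n → ℝ) : dotp a (-b) = -dotp a b := by
  simp [dotp]

lemma dotp_smul_right {n : ℕ} (c : ℝ) (a b : Fin n → ℝ) :
    dotp a (c • b) = c * dotp a b := by
  simp only [dotp, Finset.mul_sum, Pi.smul_apply, smul_eq_mul]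
  exact Finset.sum_congr rfl fun i _ => by ring

lemma dotp_zero_left {n : ℕ} (b : Fin n → ℝ) : dotp 0 b = 0 := by
  simp [dotp]

lemma dotp_zero_right {n : ℕ} (a : Fin n → ℝ) : dotp a 0 = 0 := by
  simp [dotp]

lemma dotp_le_of_sum_abs_le_one {n : ℕ} {a : Fin n → ℝ} (b : Fin n → ℝ)
    (ha : ∑ i, |a i| ≤ 1) : dotp a b ≤ ∑ i, |b i| := by
  refine Finset.sum_le_sum fun i _ => ?_
  have hi : |a i| ≤ 1 :=
    (Finset.single_le_sum (f := fun i => |a i|) (fun _ _ => abs_nonneg _)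
      (Finset.mem_univ i)).trans ha
  calc a i * b i ≤ |a i * b i| := le_abs_self _
    _ = |a i| * |b i| := abs_mul _ _
    _ ≤ |b i| := mul_le_of_le_one_left (abs_nonneg _) hi

lemma smul_mem_polarCone {n : ℕ} {C : Set (Fin n → ℝ)} {l : Fin n → ℝ}
    (hl : l ∈ polarCone C) {c : ℝ} (hc : 0 ≤ c) : c • l ∈ polarCone C := fun x hx => by
  rw [dotp_smul_left]
  exact mul_nonneg hc (hl x hx)

lemma zero_mem_polarCone {n : ℕ} (C : Set (Fin n → ℝ)) : 0 ∈ polarCone C := fun x _ =>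
  (dotp_zero_left x).ge

/-- A linear functional bounded below on a cone is nonnegative on it. -/
lemma mem_polarCone_of_bddBelow {n : ℕ} {C : Set (Fin n → ℝ)} {l : Fin n → ℝ}
    (hcone : ∀ c : ℝ, 0 ≤ c → ∀ x ∈ C, c • x ∈ C) {b : ℝ} (hb : ∀ x ∈ C, b ≤ dotp l x) :
    l ∈ polarCone C := by
  intro x hx
  by_contra! hneg
  have h := hb _ (hcone ((|b| + 1) / (-dotp l x)) (by
    have : 0 < -dotp l x := by linarith
    positivity) x hx)
  rw [dotp_smul_right, div_mul_eq_mul_div, mul_div_assoc, div_neg, div_self hneg.ne] at h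
  linarith [neg_abs_le b]

lemma exists_polarCone_dotp_neg {n : ℕ} {K : Set (Fin n → ℝ)}
    (hK : IsClosedConvexPointedCone K) {y : Fin n → ℝ} (hy : y ∉ K) :
    ∃ l ∈ polarCone K, dotp l y < 0 := by
  obtain ⟨hcl, hconv, h0, hcone, -⟩ := hK
  obtain ⟨φ, b, hφy, hφ⟩ := geometric_hahn_banach_point_closed hconv hcl hy
  obtain ⟨l, hl⟩ := exists_dotp_eq φ
  simp only [hl] at hφy hφ
  refine ⟨l, mem_polarCone_of_bddBelow hcone fun x hx => (hφ x hx).le, ?_⟩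
  have := hφ 0 h0
  rw [dotp_zero_right] at this
  linarith

lemma exists_polarCone_ne_zero_dotp_nonpos {n : ℕ} {C : Set (Fin n → ℝ)}
    (hC : IsClosedConvexPointedCone C) (hint : (interior C).Nonempty)
    {y : Fin n → ℝ} (hy : y ∉ interior C) :
    ∃ l ∈ polarCone C, l ≠ 0 ∧ dotp l y ≤ 0 := by
  obtain ⟨-, hconv, h0, hcone, -⟩ := hC
  obtain ⟨φ, hφ⟩ := geometric_hahn_banach_point_open hconv.interior isOpen_interior hy
  obtain ⟨l, hl⟩ := exists_dotp_eq φ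
  have hle : ∀ x ∈ C, dotp l y ≤ dotp l x := by
    intro x hx
    have hx' : x ∈ closure (interior C) := by
      rw [hconv.closure_interior_eq_closure_of_nonempty_interior hint]
      exact subset_closure hx
    rw [← hl, ← hl]
    exact closure_minimal (fun a ha => (hφ a ha).le)
      (isClosed_le continuous_const φ.continuous) hx'
  refine ⟨l, mem_polarCone_of_bddBelow hcone hle, ?_, ?_⟩
  · rintro rfl
    obtain ⟨a, ha⟩ := hint
    have := hφ a ha
    simp [hl, dotp_zero_left] at this
  · simpa [dotp_zero_right] using hle 0 h0

lemma bddAbove_image_LambdaSet {n m : ℕ} (C : Set (Fin n → ℝ)) (K : Set (Fin m → ℝ))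
    (y : Fin n → ℝ) (z : Fin m → ℝ) :
    BddAbove ((fun p => dotp p.1 y + dotp p.2 z) '' LambdaSet C K) := by
  refine ⟨∑ i, |y i| + ∑ j, |z j|, ?_⟩
  rintro _ ⟨p, ⟨-, -, hp⟩, rfl⟩
  have h1 : 0 ≤ ∑ i, |p.1 i| := Finset.sum_nonneg fun _ _ => abs_nonneg _
  have h2 : 0 ≤ ∑ i, |p.2 i| := Finset.sum_nonneg fun _ _ => abs_nonneg _
  exact add_le_add (dotp_le_of_sum_abs_le_one y (by linarith))
    (dotp_le_of_sum_abs_le_one z (by linarith))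

lemma sum_abs_pos_of_ne_zero {n : ℕ} {a : Fin n → ℝ} (ha : a ≠ 0) : 0 < ∑ i, |a i| := by
  obtain ⟨i, hi⟩ := Function.ne_iff.mp ha
  exact Finset.sum_pos' (fun _ _ => abs_nonneg _) ⟨i, Finset.mem_univ i, abs_pos.mpr hi⟩

lemma sSup_image_LambdaSet_nonneg {n m : ℕ} {C : Set (Fin n → ℝ)} {K : Set (Fin m → ℝ)}
    {y : Fin n → ℝ} {z : Fin m → ℝ} {l : Fin n → ℝ} {k : Fin m → ℝ}
    (hl : l ∈ polarCone C) (hk : k ∈ polarCone K)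
    (hpos : 0 < ∑ i, |l i| + ∑ j, |k j|) (h : 0 ≤ dotp l y + dotp k z) :
    0 ≤ sSup ((fun p => dotp p.1 y + dotp p.2 z) '' LambdaSet C K) := by
  set r := ∑ i, |l i| + ∑ j, |k j| with hr
  have hr0 : 0 ≤ r⁻¹ := inv_nonneg.mpr hpos.le
  refine le_csSup_of_le (bddAbove_image_LambdaSet C K y z)
    ⟨(r⁻¹ • l, r⁻¹ • k), ⟨smul_mem_polarCone hl hr0, smul_mem_polarCone hk hr0, ?_⟩, rfl⟩ ?_
  · simp only [Pi.smul_apply, smul_eq_mul, abs_mul, abs_of_nonneg hr0, ← Finset.mul_sum]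
    rw [← mul_add, ← hr, inv_mul_cancel₀ hpos.ne']
  · simp only [dotp_smul_left]
    rw [← mul_add]
    exact mul_nonneg hr0 h

lemma Ffun_self_nonpos {s n m : ℕ} (C : Set (Fin n → ℝ)) {K : Set (Fin m → ℝ)}
    (f : (Fin s → ℝ) → (Fin n → ℝ)) {g : (Fin s → ℝ) → (Fin m → ℝ)}
    {xbar : Fin s → ℝ} (hfeas : g xbar ∈ -K) : Ffun C K f g xbar xbar ≤ 0 := by
  refine Real.sSup_nonpos ?_
  rintro _ ⟨p, ⟨-, hp, -⟩, rfl⟩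
  have := hp _ hfeas
  rw [dotp_neg_right] at this
  simp only [sub_self, dotp_zero_right]
  linarith

lemma Ffun_nonneg {s n m : ℕ} {C : Set (Fin n → ℝ)} {K : Set (Fin m → ℝ)}
    (hC : IsClosedConvexPointedCone C) (hK : IsClosedConvexPointedCone K)
    (hCint : (interior C).Nonempty)
    {f : (Fin s → ℝ) → (Fin n → ℝ)} {g : (Fin s → ℝ) → (Fin m → ℝ)} {xbar x : Fin s → ℝ}
    (hx : g x ∈ -K → f x ∉ ({f xbar} : Set (Fin n → ℝ)) - interior C) :
    0 ≤ Ffun C K f g xbar x := by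
  by_cases hg : g x ∈ -K
  · have hy : f xbar - f x ∉ interior C := fun h =>
      hx hg (Set.mem_sub.mpr ⟨f xbar, rfl, _, h, sub_sub_cancel _ _⟩)
    obtain ⟨l, hl, hl0, hly⟩ := exists_polarCone_ne_zero_dotp_nonpos hC hCint hy
    refine sSup_image_LambdaSet_nonneg hl (zero_mem_polarCone K) ?_ ?_
    · simpa using sum_abs_pos_of_ne_zero hl0
    · rw [← neg_sub, dotp_neg_right] at hly
      rw [dotp_zero_left]
      linarith
  · obtain ⟨k, hk, hkg⟩ := exists_polarCone_dotp_neg hK (y := -g x) hg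
    rw [dotp_neg_right] at hkg
    refine sSup_image_LambdaSet_nonneg (zero_mem_polarCone C) hk ?_ ?_
    · have hk0 : k ≠ 0 := by
        rintro rfl
        simp [dotp_zero_left] at hkg
      simpa using sum_abs_pos_of_ne_zero hk0
    · rw [dotp_zero_left]
      linarith

/-- If `x̄` is a weak local minimizer of (P), then the lower Hadamard directional
derivative of `F` at `x̄` is nonnegative in every direction. -/
theorem stmt_1 {s n m : ℕ}
    (C : Set (Fin n → ℝ)) (K : Set (Fin m → ℝ))
    (hC : IsClosedConvexPointedCone C) (hK : IsClosedConvexPointedCone K)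
    (hCint : (interior C).Nonempty)
    (X : Set (Fin s → ℝ)) (hX : IsOpen X)
    (f : (Fin s → ℝ) → (Fin n → ℝ)) (g : (Fin s → ℝ) → (Fin m → ℝ))
    (xbar : Fin s → ℝ) (hxX : xbar ∈ X) (hxfeas : g xbar ∈ -K)
    (hmin : WeakLocalMin C K X f g xbar) :
    ∀ u : Fin s → ℝ, (0 : EReal) ≤ lowerHadamardDeriv (Ffun C K f g xbar) xbar u := by
  intro u
  obtain ⟨N, hN, hmin⟩ := hmin
  have hlim : Tendsto (fun p : ℝ × (Fin s → ℝ) => xbar + p.1 • p.2)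
      ((𝓝[>] (0 : ℝ)) ×ˢ 𝓝 u) (𝓝 xbar) := by
    have hc : Continuous fun p : ℝ × (Fin s → ℝ) => xbar + p.1 • p.2 := by fun_prop
    have h := hc.tendsto (0, u)
    rw [nhds_prod_eq] at h
    simp only [zero_smul, add_zero] at h
    exact h.mono_left (Filter.prod_mono nhdsWithin_le_nhds le_rfl)
  have hpos : ∀ᶠ p : ℝ × (Fin s → ℝ) in (𝓝[>] (0 : ℝ)) ×ˢ 𝓝 u, 0 < p.1 :=
    tendsto_fst.eventually self_mem_nhdsWithin
  refine le_liminf_of_le (by isBoundedDefault) ?_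
  filter_upwards [hpos, hlim hN, hlim (hX.mem_nhds hxX)] with p hp hpN hpX
  have h1 := Ffun_nonneg hC hK hCint (hmin _ hpN hpX)
  have h2 := Ffun_self_nonpos C f hxfeas
  exact EReal.coe_nonneg.mpr (div_nonneg (by linarith) hp.le)
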